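/- Let 1 < p < 3, 1 < ρ < 2/(p−1), and q ∈ [1,∞). Then as t → ∞, the L^q(ℝ) norm of x ↦ ((p−1)t + (e^{tΔ}⟨·⟩^{−ρ}(x))^{1−p})^{−1/(p−1)} is O( t^{1/(qρ(p−1)) − 1/(p−1)} ). -/

import Mathlib

open Real MeasureTheory

/-- The one-dimensional heat semigroup `e^{tΔ}f(x) = (4πt)^{-1/2} ∫ e^{-y²/(4t)} f(x-y) dy`. -/
noncomputable def heatSemigroup (t : ℝ) (f : ℝ → ℝ) (x : ℝ) : ℝ :=
  (4 * Real.pi * t) ^ (-(1:ℝ)/2) * ∫ y : ℝ, Real.exp (-y ^ 2 / (4 * t)) * f (x - y)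

theorem integrable_exp_neg_sq_div {t : ℝ} (ht : 0 < t) :
    Integrable (fun y : ℝ => Real.exp (-y ^ 2 / t)) := by
  have h := integrable_exp_neg_mul_sq (b := 1 / t) (by positivity)
  refine h.congr (Filter.Eventually.of_forall fun y => ?_)
  simp only
  congr 1
  ring

theorem integral_exp_neg_sq_div (t : ℝ) :
    ∫ y : ℝ, Real.exp (-y ^ 2 / t) = √(Real.pi * t) := by
  have h := integral_gaussian (1 / t)
  rw [div_div_eq_mul_div, div_one] at h
  rw [← h]
  congr 1
  ext y
  congr 1
  ring

theorem integrable_heat_integrand {t : ℝ} (ht : 0 < t) {f : ℝ → ℝ} (hf : Continuous f)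
    (hf0 : ∀ y, 0 < f y) (hf1 : ∀ y, f y ≤ 1) (x : ℝ) :
    Integrable (fun y : ℝ => Real.exp (-y ^ 2 / (4 * t)) * f (x - y)) := by
  refine (integrable_exp_neg_sq_div (t := 4 * t) (by positivity)).mul_bdd (c := 1)
    (by fun_prop) (Filter.Eventually.of_forall fun y => ?_)
  rw [Real.norm_of_nonneg (hf0 _).le]
  exact hf1 _

theorem heatSemigroup_pos {t : ℝ} (ht : 0 < t) {f : ℝ → ℝ} (hf : Continuous f)
    (hf0 : ∀ y, 0 < f y) (hf1 : ∀ y, f y ≤ 1) (x : ℝ) : 0 < heatSemigroup t f x := by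
  have h : 0 < ∫ y : ℝ, Real.exp (-y ^ 2 / (4 * t)) * f (x - y) :=
    integral_pos_of_integrable_nonneg_nonzero (x := 0) (by fun_prop)
      (integrable_heat_integrand ht hf hf0 hf1 x)
      (fun y => (mul_pos (Real.exp_pos _) (hf0 _)).le)
      (mul_pos (Real.exp_pos _) (hf0 _)).ne'
  unfold heatSemigroup
  have := Real.pi_pos
  positivity

/-- If `f` is bounded by `1` everywhere and by `B` on the ball of radius `|x| / 2` around `x`, then
the heat flow at `x` is bounded by `B` up to a Gaussian tail. -/
theorem heatSemigroup_le_add_exp {t : ℝ} (ht : 0 < t) {f : ℝ → ℝ} (hf : Continuous f)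
    (hf0 : ∀ y, 0 < f y) (hf1 : ∀ y, f y ≤ 1) {x B : ℝ} (hB : 0 ≤ B)
    (hxB : ∀ y, |y| ≤ |x| / 2 → f (x - y) ≤ B) :
    heatSemigroup t f x ≤ B + √2 * Real.exp (-x ^ 2 / (32 * t)) := by
  have hpt : ∀ y : ℝ, Real.exp (-y ^ 2 / (4 * t)) * f (x - y) ≤
      Real.exp (-y ^ 2 / (4 * t)) * B +
        Real.exp (-x ^ 2 / (32 * t)) * Real.exp (-y ^ 2 / (8 * t)) := by
    intro y
    rcases le_or_gt |y| (|x| / 2) with h | h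
    · have := mul_le_mul_of_nonneg_left (hxB y h) (Real.exp_pos (-y ^ 2 / (4 * t))).le
      have : 0 < Real.exp (-x ^ 2 / (32 * t)) * Real.exp (-y ^ 2 / (8 * t)) := by positivity
      linarith
    · have hxy : x ^ 2 ≤ 4 * y ^ 2 := by
        rw [← sq_abs x, ← sq_abs y]
        nlinarith [abs_nonneg x]
      have h1 : Real.exp (-y ^ 2 / (4 * t)) ≤
          Real.exp (-x ^ 2 / (32 * t)) * Real.exp (-y ^ 2 / (8 * t)) := by
        rw [← Real.exp_add, Real.exp_le_exp, div_add_div _ _ (by positivity) (by positivity),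
          div_le_div_iff₀ (by positivity) (by positivity)]
        nlinarith [mul_le_mul_of_nonneg_left hxy (by positivity : 0 ≤ t ^ 2)]
      have h2 := mul_le_mul_of_nonneg_left (hf1 (x - y)) (Real.exp_pos (-y ^ 2 / (4 * t))).le
      have h3 : 0 ≤ Real.exp (-y ^ 2 / (4 * t)) * B := by positivity
      linarith
  have hi4 := integrable_exp_neg_sq_div (t := 4 * t) (by positivity)
  have hi8 := integrable_exp_neg_sq_div (t := 8 * t) (by positivity)
  have hint := integral_mono (integrable_heat_integrand ht hf hf0 hf1 x)
    ((hi4.mul_const B).add (hi8.const_mul (Real.exp (-x ^ 2 / (32 * t))))) hpt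
  simp only [Pi.add_apply] at hint
  rw [integral_add (hi4.mul_const B) (hi8.const_mul _), integral_mul_const, integral_const_mul,
    integral_exp_neg_sq_div, integral_exp_neg_sq_div] at hint
  have hpi := Real.pi_pos
  have hs : 0 < √(4 * Real.pi * t) := by positivity
  have e1 : (4 * Real.pi * t) ^ (-(1 : ℝ) / 2) = (√(4 * Real.pi * t))⁻¹ := by
    rw [Real.sqrt_eq_rpow, ← Real.rpow_neg (by positivity)]
    norm_num
  have e2 : √(Real.pi * (4 * t)) = √(4 * Real.pi * t) := by
    congr 1
    ring
  have e3 : √(Real.pi * (8 * t)) = √2 * √(4 * Real.pi * t) := by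
    rw [← Real.sqrt_mul (by norm_num)]
    congr 1
    ring
  unfold heatSemigroup
  rw [e1, inv_mul_le_iff₀ hs]
  rw [e2, e3] at hint
  linarith

theorem exp_neg_le_rpow_neg {s z : ℝ} (hs : 0 < s) (hz : 0 < z) :
    Real.exp (-z) ≤ (z / s) ^ (-s) := by
  have h : z / s ≤ Real.exp (z / s) := by linarith [Real.add_one_le_exp (z / s)]
  have h2 := Real.rpow_le_rpow_of_nonpos (by positivity) h (neg_nonpos.2 hs.le)
  rwa [← Real.exp_mul, div_mul_eq_mul_div, mul_neg, neg_div, mul_div_assoc, div_self hs.ne',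
    mul_one] at h2

theorem continuous_japanese_rpow (ρ : ℝ) :
    Continuous (fun y : ℝ => ((1 + y ^ 2) ^ ((1:ℝ)/2)) ^ (-ρ)) := by
  have h1 : Continuous (fun y : ℝ => (1 + y ^ 2) ^ ((1:ℝ)/2)) :=
    (by fun_prop : Continuous fun y : ℝ => 1 + y ^ 2).rpow_const fun y => Or.inr (by norm_num)
  exact h1.rpow_const fun y => Or.inl (by positivity)

theorem japanese_rpow_le_one {ρ : ℝ} (hρ : 0 ≤ ρ) (y : ℝ) :
    ((1 + y ^ 2) ^ ((1:ℝ)/2)) ^ (-ρ) ≤ 1 :=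
  Real.rpow_le_one_of_one_le_of_nonpos
    (Real.one_le_rpow (by nlinarith [sq_nonneg y]) (by norm_num)) (by linarith)

theorem japanese_rpow_le {ρ r y : ℝ} (hρ : 0 ≤ ρ) (hr : 0 < r) (hry : r ≤ |y|) :
    ((1 + y ^ 2) ^ ((1:ℝ)/2)) ^ (-ρ) ≤ r ^ (-ρ) := by
  refine Real.rpow_le_rpow_of_nonpos hr ?_ (by linarith)
  rw [← Real.sqrt_eq_rpow]
  exact Real.le_sqrt_of_sq_le (by nlinarith [sq_abs y])

/-- Outside the parabolic region, the heat flow of `⟨·⟩^{-ρ}` keeps the spatial decay of its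
initial datum. -/
theorem heatSemigroup_japanese_le {a ρ : ℝ} (ha : 0 < a) (hρ : 0 < ρ) (hρa : ρ * a < 2) :
    ∃ C > (0:ℝ), ∀ t > (0:ℝ), ∀ x : ℝ, t ^ (1 / (ρ * a)) ≤ |x| →
      heatSemigroup t (fun y => ((1 + y ^ 2) ^ ((1:ℝ)/2)) ^ (-ρ)) x ≤ C * |x| ^ (-ρ) := by
  set δ := 2 - ρ * a with hδ
  have hδ0 : 0 < δ := by linarith
  set s := ρ / δ with hs
  have hs0 : 0 < s := by positivity
  refine ⟨2 ^ ρ + √2 * (32 * s) ^ s, by positivity, fun t ht x hx => ?_⟩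
  have hx0 : 0 < |x| := lt_of_lt_of_le (by positivity) hx
  have hmain := heatSemigroup_le_add_exp ht (continuous_japanese_rpow ρ)
    (fun y => by positivity) (japanese_rpow_le_one hρ.le) (x := x) (B := (|x| / 2) ^ (-ρ))
    (by positivity) (fun y hy => japanese_rpow_le hρ.le (by positivity) (by
      have := abs_sub_abs_le_abs_sub x y
      linarith))
  have htx : t ≤ |x| ^ (ρ * a) := by
    have h := Real.rpow_le_rpow (by positivity) hx (by positivity : 0 ≤ ρ * a)
    rwa [← Real.rpow_mul ht.le, one_div, inv_mul_cancel₀ (by positivity), Real.rpow_one] at h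
  have hz : |x| ^ δ / 32 ≤ x ^ 2 / (32 * t) := by
    rw [div_le_div_iff₀ (by norm_num) (by positivity)]
    have : |x| ^ δ * |x| ^ (ρ * a) = x ^ 2 := by
      rw [← Real.rpow_add hx0, hδ, sub_add_cancel, Real.rpow_two, sq_abs]
    nlinarith [mul_le_mul_of_nonneg_left htx (Real.rpow_nonneg hx0.le δ)]
  have hexp : Real.exp (-x ^ 2 / (32 * t)) ≤ (32 * s) ^ s * |x| ^ (-ρ) := by
    calc Real.exp (-x ^ 2 / (32 * t)) ≤ Real.exp (-(|x| ^ δ / 32)) := by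
          rw [Real.exp_le_exp, neg_div]
          linarith
      _ ≤ (|x| ^ δ / 32 / s) ^ (-s) := exp_neg_le_rpow_neg hs0 (by positivity)
      _ = (32 * s) ^ s * |x| ^ (-ρ) := by
          rw [div_div, Real.div_rpow (by positivity) (by positivity), ← Real.rpow_mul hx0.le,
            Real.rpow_neg (by positivity : 0 ≤ 32 * s), div_inv_eq_mul, mul_comm]
          congr 2
          rw [hs]
          field_simp
  have hhalf : (|x| / 2) ^ (-ρ) = 2 ^ ρ * |x| ^ (-ρ) := by
    rw [Real.div_rpow hx0.le (by norm_num), Real.rpow_neg (by norm_num : (0:ℝ) ≤ 2),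
      div_inv_eq_mul, mul_comm]
  rw [hhalf] at hmain
  nlinarith [mul_le_mul_of_nonneg_left hexp (Real.sqrt_nonneg 2)]

/-- The rescaled profile `(1 + |x / R|)^{-ρ}` has `L^q` norm of order `R^{1/q}`. -/
theorem eLpNorm_const_mul_one_add_abs_div_rpow {ρ q : ℝ} (hρ : 1 < ρ) (hq : 1 ≤ q) :
    ∃ I ≥ (0:ℝ), ∀ A ≥ (0:ℝ), ∀ R > (0:ℝ),
      eLpNorm (fun x : ℝ => A * (1 + |x / R|) ^ (-ρ)) (ENNReal.ofReal q) volume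
        = ENNReal.ofReal (A * R ^ (1 / q) * I) := by
  have hq0 : 0 < q := by linarith
  refine ⟨(∫ x : ℝ, (1 + |x|) ^ (-(ρ * q))) ^ (1 / q), by positivity, fun A hA R hR => ?_⟩
  have hint : Integrable (fun x : ℝ => (1 + |x|) ^ (-(ρ * q))) := by
    have := integrable_one_add_norm (E := ℝ) (μ := volume) (r := ρ * q) (by
      simp only [Module.finrank_self, Nat.cast_one]
      nlinarith)
    simpa only [Real.norm_eq_abs] using this
  have hpow : ∀ x : ℝ, ‖A * (1 + |x / R|) ^ (-ρ)‖ ^ q = A ^ q * (1 + |x / R|) ^ (-(ρ * q)) := by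
    intro x
    rw [Real.norm_of_nonneg (by positivity), Real.mul_rpow hA (by positivity),
      ← Real.rpow_mul (by positivity), neg_mul]
  have hq' : (ENNReal.ofReal q).toReal = q := ENNReal.toReal_ofReal hq0.le
  have hne : ENNReal.ofReal q ≠ 0 := by simpa using hq0
  have hmem : MemLp (fun x : ℝ => A * (1 + |x / R|) ^ (-ρ)) (ENNReal.ofReal q) volume := by
    have hcont : Continuous (fun x : ℝ => A * (1 + |x / R|) ^ (-ρ)) :=
      continuous_const.mul ((by fun_prop : Continuous fun x : ℝ => 1 + |x / R|).rpow_const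
        fun x => Or.inl (by positivity))
    rw [← integrable_norm_rpow_iff hcont.aestronglyMeasurable hne ENNReal.ofReal_ne_top, hq']
    simp only [hpow]
    exact (hint.comp_div hR.ne').const_mul _
  rw [hmem.eLpNorm_eq_integral_rpow_norm hne ENNReal.ofReal_ne_top, hq']
  simp only [hpow]
  rw [integral_const_mul, Measure.integral_comp_div (fun x : ℝ => (1 + |x|) ^ (-(ρ * q))),
    abs_of_pos hR, smul_eq_mul, Real.mul_rpow (by positivity) (by positivity),
    Real.mul_rpow hR.le (by positivity), ← Real.rpow_mul hA, mul_inv_cancel₀ hq0.ne',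
    Real.rpow_one, one_div, mul_assoc]

theorem heat_supersolution_Lq_decay {p ρ q : ℝ} (hp1 : 1 < p) (hp3 : p < 3)
    (hρ1 : 1 < ρ) (hρ2 : ρ < 2 / (p - 1)) (hq : 1 ≤ q) :
    ∃ C > (0:ℝ), ∃ T : ℝ, ∀ t : ℝ, T ≤ t →
      eLpNorm
          (fun x : ℝ =>
            ((p - 1) * t
                + heatSemigroup t (fun y => ((1 + y ^ 2) ^ ((1:ℝ)/2)) ^ (-ρ)) x ^ (1 - p))
              ^ (-(1 / (p - 1))))
          (ENNReal.ofReal q) volume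
        ≤ ENNReal.ofReal (C * t ^ (1 / (q * ρ * (p - 1)) - 1 / (p - 1))) := by
  set a := p - 1 with ha_def
  have ha : 0 < a := by linarith
  have hρ0 : 0 < ρ := by linarith
  have hρa : ρ * a < 2 := by rwa [lt_div_iff₀ ha] at hρ2
  have hp : 1 - p = -a := by rw [ha_def]; ring
  obtain ⟨C₁, hC₁, hu⟩ := heatSemigroup_japanese_le ha hρ0 hρa
  obtain ⟨I, hI, hnorm⟩ := eLpNorm_const_mul_one_add_abs_div_rpow hρ1 hq
  set K := (C₁ + a ^ (-(1 / a))) * 2 ^ ρ with hK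
  have hK0 : 0 < K := by positivity
  refine ⟨K * (I + 1), by positivity, 1, fun t ht1 => ?_⟩
  have ht : 0 < t := by linarith
  set R := t ^ (1 / (ρ * a)) with hR
  have hR0 : 0 < R := by positivity
  have hRt : R ^ (-ρ) = t ^ (-(1 / a)) := by
    rw [hR, ← Real.rpow_mul ht.le]
    congr 1
    field_simp
  have hdecay : ∀ x r : ℝ, 0 < r → (R + |x|) / 2 ≤ r →
      r ^ (-ρ) ≤ 2 ^ ρ * R ^ (-ρ) * (1 + |x / R|) ^ (-ρ) := by
    intro x r hr h
    have h1 := Real.rpow_le_rpow_of_nonpos (by positivity) h (by linarith : -ρ ≤ 0)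
    have h2 : (R + |x|) / 2 = R * (1 + |x / R|) / 2 := by
      rw [abs_div, abs_of_pos hR0]
      field_simp
    rw [h2, Real.div_rpow (by positivity) (by norm_num), Real.mul_rpow hR0.le (by positivity),
      Real.rpow_neg (by norm_num : (0:ℝ) ≤ 2), div_inv_eq_mul] at h1
    linarith
  have hbound : ∀ x : ℝ, ‖(a * t + heatSemigroup t
      (fun y => ((1 + y ^ 2) ^ ((1:ℝ)/2)) ^ (-ρ)) x ^ (1 - p)) ^ (-(1 / a))‖ ≤
      K * R ^ (-ρ) * (1 + |x / R|) ^ (-ρ) := by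
    intro x
    have hupos := heatSemigroup_pos ht (continuous_japanese_rpow ρ)
      (fun y => by positivity) (japanese_rpow_le_one hρ0.le) x
    have hux := hu t ht x
    set u := heatSemigroup t (fun y => ((1 + y ^ 2) ^ ((1:ℝ)/2)) ^ (-ρ)) x
    have hua : 0 < u ^ (-a) := Real.rpow_pos_of_pos hupos _
    have hat : 0 < a * t := by positivity
    have hneg : -(1 / a) ≤ 0 := by
      have : 0 < 1 / a := by positivity
      linarith
    rw [hp, Real.norm_of_nonneg (by positivity)]
    have hprof : 0 < 2 ^ ρ * R ^ (-ρ) * (1 + |x / R|) ^ (-ρ) := by positivity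
    have hapos : 0 < a ^ (-(1 / a)) := by positivity
    rcases le_total R |x| with h | h
    · have h1 := Real.rpow_le_rpow_of_nonpos hua (by linarith : u ^ (-a) ≤ a * t + u ^ (-a)) hneg
      have h2 : (u ^ (-a)) ^ (-(1 / a)) = u := by
        rw [← Real.rpow_mul hupos.le, neg_mul_neg, mul_one_div_cancel ha.ne', Real.rpow_one]
      have h3 := mul_le_mul_of_nonneg_left
        (hdecay x |x| (by linarith) (by linarith)) hC₁.le
      have h4 := hux h
      rw [hK]
      nlinarith [mul_pos hapos hprof]
    · have h1 := Real.rpow_le_rpow_of_nonpos hat (by linarith : a * t ≤ a * t + u ^ (-a)) hneg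
      rw [Real.mul_rpow ha.le ht.le, ← hRt] at h1
      have h3 := mul_le_mul_of_nonneg_left (hdecay x R hR0 (by linarith)) hapos.le
      rw [hK]
      nlinarith [mul_pos hC₁ hprof]
  refine (eLpNorm_mono_real hbound).trans ?_
  rw [hnorm _ (by positivity) R hR0]
  refine ENNReal.ofReal_le_ofReal ?_
  have hexp : t ^ (1 / (q * ρ * a) - 1 / a) = R ^ (-ρ) * R ^ (1 / q) := by
    rw [hRt, hR, ← Real.rpow_mul ht.le, ← Real.rpow_add ht]
    congr 1
    field_simp
    ring
  rw [hexp]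
  have : 0 < K * (R ^ (-ρ) * R ^ (1 / q)) := by positivity
  nlinarith
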